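/- Let ξ* ∈ D(v,d,q·1_d) be feasible with completely symmetric information matrix N(ξ*) = a I_v + b J_v, and suppose ξ* minimizes trace(N̄(ξ)^{−1}) over all feasible ξ ∈ D(v,d,q·1_d), where N̄(ξ) := (1/v!) Σ_π P_π N(ξ) P_π^T is the average over all permutation matrices P_π of the v test treatments. Then ξ* minimizes Π_{i=1}^{v} (N(ξ)^{−1})_{ii} over all feasible ξ ∈ D(v,d,q·1_d), i.e., ξ* is R-optimal in D(v,d,q·1_d). -/

import Mathlib

open Matrix BigOperators Finset

/-- An exact block design in `D(v,d,m)`: `v` test treatments (labelled `1,…,v`, with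
treatment `0` the control), `d` blocks of sizes `m_1,…,m_d`; `w i k` is the number of
trials of treatment `i` in block `k`. -/
structure ExactDesign (v d : ℕ) (m : Fin d → ℕ) where
  w : Fin (v + 1) → Fin d → ℕ
  block_sum : ∀ k, ∑ i, w i k = m k

namespace ExactDesign

variable {v d : ℕ} {m : Fin d → ℕ}

/-- Treatment replications `r_i(ξ)`. -/
def r (ξ : ExactDesign v d m) (i : Fin (v + 1)) : ℕ := ∑ k, ξ.w i k

/-- Concurrences `μ_{ij}(ξ) = Σ_k ξ(i,k) ξ(j,k)`. -/
def mu (ξ : ExactDesign v d m) (i j : Fin (v + 1)) : ℕ := ∑ k, ξ.w i k * ξ.w j k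

/-- The information matrix `N(ξ) = diag(r_1,…,r_v) − Z diag(m⁻¹) Zᵀ` for comparing
the test treatments with the control. -/
noncomputable def N (ξ : ExactDesign v d m) : Matrix (Fin v) (Fin v) ℝ :=
  Matrix.of fun i j =>
    (if i = j then (ξ.r i.succ : ℝ) else 0)
      - ∑ k, (ξ.w i.succ k : ℝ) * (ξ.w j.succ k : ℝ) / (m k : ℝ)

end ExactDesign

/-- The smallest eigenvalue of a real matrix, as the infimum of its spectrum. -/
noncomputable def lamMin {n : ℕ} (A : Matrix (Fin n) (Fin n) ℝ) : ℝ :=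
  sInf (spectrum ℝ A)

/-- The sum of the variances plus the sum of absolute values of the covariances of
the treatment-control contrast estimators: `Σ_i (A⁻¹)_{ii} + Σ_{i ≠ j} |(A⁻¹)_{ij}|`. -/
noncomputable def varCovSum {n : ℕ} (A : Matrix (Fin n) (Fin n) ℝ) : ℝ :=
  ∑ i, A⁻¹ i i + ∑ i, ∑ j, if i = j then 0 else |A⁻¹ i j|

/-- The average `N̄ = (1/v!) Σ_π P_π N P_πᵀ` of a matrix over all simultaneous
permutations of its rows and columns. -/
noncomputable def permAvg {n : ℕ} (A : Matrix (Fin n) (Fin n) ℝ) :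
    Matrix (Fin n) (Fin n) ℝ :=
  ((Nat.factorial n : ℝ))⁻¹ • ∑ π : Equiv.Perm (Fin n), A.submatrix ⇑π ⇑π

theorem Matrix.PosDef.sq_le_inv_diag_mul_dotProduct {n : Type*} [Fintype n] [DecidableEq n]
    {A : Matrix n n ℝ} (hA : A.PosDef) (y : n → ℝ) (i : n) :
    y i ^ 2 ≤ A⁻¹ i i * (y ⬝ᵥ A *ᵥ y) := by
  have hpos : 0 < A⁻¹ i i := hA.inv.diag_pos
  have hdet : IsUnit A.det := (Matrix.isUnit_iff_isUnit_det A).1 hA.isUnit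
  set z : n → ℝ := A⁻¹ *ᵥ Pi.single i 1 with hz
  have hAz : A *ᵥ z = Pi.single i 1 := by
    rw [hz, Matrix.mulVec_mulVec, Matrix.mul_nonsing_inv A hdet, Matrix.one_mulVec]
  have hzi : z i = A⁻¹ i i := by simp [hz]
  have hsymm : z ⬝ᵥ A *ᵥ y = y i := by
    have hT : Aᵀ = A := by simpa using hA.isHermitian.eq
    rw [Matrix.dotProduct_mulVec, ← Matrix.mulVec_transpose, hT, hAz, single_one_dotProduct]
  have h := hA.posSemidef.dotProduct_mulVec_nonneg (A⁻¹ i i • y - y i • z)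
  simp only [star_trivial, Matrix.mulVec_sub, Matrix.mulVec_smul, sub_dotProduct, dotProduct_sub,
    smul_dotProduct, dotProduct_smul, hAz, hsymm, dotProduct_single_one, Pi.sub_apply,
    Pi.smul_apply, hzi, smul_eq_mul] at h
  have h' : 0 ≤ A⁻¹ i i * (A⁻¹ i i * (y ⬝ᵥ A *ᵥ y) - y i ^ 2) := by linarith
  linarith [nonneg_of_mul_nonneg_right h' hpos]

theorem Matrix.inv_diag_eq_of_submatrix_perm {n : Type*} [Fintype n] [DecidableEq n]
    {A : Matrix n n ℝ} (hA : ∀ σ : Equiv.Perm n, A.submatrix σ σ = A) (i j : n) :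
    A⁻¹ i i = A⁻¹ j j := by
  have h := Matrix.inv_submatrix_equiv A (Equiv.swap i j) (Equiv.swap i j)
  rw [hA] at h
  simpa using congrFun (congrFun h i) i

theorem permAvg_submatrix_perm {n : ℕ} (A : Matrix (Fin n) (Fin n) ℝ)
    (σ : Equiv.Perm (Fin n)) : (permAvg A).submatrix σ σ = permAvg A := by
  ext i j
  simp only [permAvg, Matrix.submatrix_apply, Matrix.smul_apply, Matrix.sum_apply]
  congr 1
  exact Equiv.sum_comp (Equiv.mulRight σ) fun π : Equiv.Perm (Fin n) => A (π i) (π j)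

theorem permAvg_eq_self {n : ℕ} {A : Matrix (Fin n) (Fin n) ℝ}
    (hA : ∀ σ : Equiv.Perm (Fin n), A.submatrix σ σ = A) : permAvg A = A := by
  have h : (Nat.factorial n : ℝ) ≠ 0 := by positivity
  simp only [permAvg, hA, Finset.sum_const, Finset.card_univ, Fintype.card_perm, Fintype.card_fin]
  rw [← Nat.cast_smul_eq_nsmul ℝ, inv_smul_smul₀ h]

theorem Matrix.PosDef.permAvg {n : ℕ} {A : Matrix (Fin n) (Fin n) ℝ} (hA : A.PosDef) :
    (permAvg A).PosDef :=
  (Matrix.posDef_sum Finset.univ_nonempty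
    fun π _ => hA.submatrix (Equiv.injective π)).smul (by positivity)

theorem card_mul_sum_perm_apply {n : ℕ} (f : Fin n → ℝ) (i : Fin n) :
    (n : ℝ) * ∑ π : Equiv.Perm (Fin n), f (π i) = (Nat.factorial n : ℝ) * ∑ j, f j := by
  have h : ∀ j, ∑ π : Equiv.Perm (Fin n), f (π j) = ∑ π : Equiv.Perm (Fin n), f (π i) := by
    intro j
    simpa using Equiv.sum_comp (Equiv.mulRight (Equiv.swap j i))
      fun π : Equiv.Perm (Fin n) => f (π i)
  calc (n : ℝ) * ∑ π : Equiv.Perm (Fin n), f (π i)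
      = ∑ j, ∑ π : Equiv.Perm (Fin n), f (π j) := by simp [h]
    _ = ∑ π : Equiv.Perm (Fin n), ∑ j, f j := by
        rw [Finset.sum_comm]
        exact Finset.sum_congr rfl fun π _ => Equiv.sum_comp π f
    _ = (Nat.factorial n : ℝ) * ∑ j, f j := by simp [Fintype.card_perm]

theorem prod_le_mean_pow {n : ℕ} (hn : n ≠ 0) (g : Fin n → ℝ) (hg : ∀ j, 0 ≤ g j) :
    ∏ j, g j ≤ ((∑ j, g j) / n) ^ n := by
  have hP : 0 ≤ ∏ j, g j := Finset.prod_nonneg fun j _ => hg j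
  have h := Real.geom_mean_le_arith_mean Finset.univ (fun _ => (1 : ℝ)) g
    (fun _ _ => zero_le_one) (by simpa using Nat.pos_of_ne_zero hn) fun j _ => hg j
  simp only [Real.rpow_one, one_mul, Finset.sum_const, Finset.card_univ, Fintype.card_fin,
    nsmul_eq_mul, mul_one] at h
  calc ∏ j, g j = ((∏ j, g j) ^ (n : ℝ)⁻¹) ^ n := (Real.rpow_inv_natCast_pow hP hn).symm
    _ ≤ _ := pow_le_pow_left₀ (Real.rpow_nonneg hP _) h n

theorem Matrix.PosDef.permAvg_inv_diag_mul_mean_le_one {n : ℕ} {A : Matrix (Fin n) (Fin n) ℝ}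
    (hA : A.PosDef) (i : Fin n) :
    (_root_.permAvg A)⁻¹ i i * ((∑ j, (A⁻¹ j j)⁻¹) / n) ≤ 1 := by
  have hn : (0 : ℝ) < n := Nat.cast_pos.2 i.pos
  have hB := hA.permAvg
  have ht : 0 < (_root_.permAvg A)⁻¹ i i := hB.inv.diag_pos
  set t := (_root_.permAvg A)⁻¹ i i with ht_def
  set x : Fin n → ℝ := (_root_.permAvg A)⁻¹ *ᵥ Pi.single i 1 with hx
  have hxi : x i = t := by simp [hx, ht_def]
  have hxB : x ⬝ᵥ _root_.permAvg A *ᵥ x = t := by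
    have hBx : _root_.permAvg A *ᵥ x = Pi.single i 1 := by
      rw [hx, Matrix.mulVec_mulVec, Matrix.mul_nonsing_inv _
        ((Matrix.isUnit_iff_isUnit_det _).1 hB.isUnit), Matrix.one_mulVec]
    rw [hBx, dotProduct_single_one, hxi]
  have hfac : (0 : ℝ) < Nat.factorial n := by positivity
  have hsum : ∑ π : Equiv.Perm (Fin n), x ⬝ᵥ A.submatrix π π *ᵥ x = Nat.factorial n * t := by
    rw [← hxB, _root_.permAvg, Matrix.smul_mulVec, dotProduct_smul, smul_eq_mul,
      mul_inv_cancel_left₀ hfac.ne', Matrix.sum_mulVec, dotProduct_sum]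
  have hle : t ^ 2 * ∑ π : Equiv.Perm (Fin n), (A⁻¹ (π i) (π i))⁻¹ ≤ Nat.factorial n * t := by
    rw [← hsum, Finset.mul_sum]
    refine Finset.sum_le_sum fun π _ => ?_
    have h := (hA.submatrix (Equiv.injective π)).sq_le_inv_diag_mul_dotProduct x i
    rw [Matrix.inv_submatrix_equiv, Matrix.submatrix_apply, hxi] at h
    rw [← div_eq_mul_inv, div_le_iff₀' hA.inv.diag_pos]
    exact h
  have hcount := card_mul_sum_perm_apply (fun j => (A⁻¹ j j)⁻¹) i
  rw [← mul_div_assoc, div_le_one hn]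
  refine le_of_mul_le_mul_left ?_ (mul_pos hfac ht)
  calc (Nat.factorial n * t) * (t * ∑ j, (A⁻¹ j j)⁻¹)
      = n * (t ^ 2 * ∑ π : Equiv.Perm (Fin n), (A⁻¹ (π i) (π i))⁻¹) := by
        linear_combination -t ^ 2 * hcount
    _ ≤ n * (Nat.factorial n * t) := mul_le_mul_of_nonneg_left hle hn.le
    _ = (Nat.factorial n * t) * n := mul_comm _ _

theorem Matrix.PosDef.permAvg_inv_diag_pow_le_prod {n : ℕ} {A : Matrix (Fin n) (Fin n) ℝ}
    (hA : A.PosDef) (i : Fin n) :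
    (_root_.permAvg A)⁻¹ i i ^ n ≤ ∏ j, A⁻¹ j j := by
  have ht : 0 < (_root_.permAvg A)⁻¹ i i := hA.permAvg.inv.diag_pos
  have ha : ∀ j, 0 < A⁻¹ j j := fun j => hA.inv.diag_pos
  have hP : 0 < ∏ j, A⁻¹ j j := Finset.prod_pos fun j _ => ha j
  have hmean := prod_le_mean_pow i.pos.ne' (fun j => (A⁻¹ j j)⁻¹) fun j => (inv_pos.2 (ha j)).le
  rw [Finset.prod_inv_distrib] at hmean
  have hle : (_root_.permAvg A)⁻¹ i i ^ n * (∏ j, A⁻¹ j j)⁻¹ ≤ 1 :=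
    calc _ ≤ (_root_.permAvg A)⁻¹ i i ^ n * ((∑ j, (A⁻¹ j j)⁻¹) / n) ^ n :=
          mul_le_mul_of_nonneg_left hmean (pow_nonneg ht.le n)
      _ = ((_root_.permAvg A)⁻¹ i i * ((∑ j, (A⁻¹ j j)⁻¹) / n)) ^ n := (mul_pow _ _ _).symm
      _ ≤ 1 := pow_le_one₀
          (mul_nonneg ht.le (div_nonneg (Finset.sum_nonneg fun j _ => (inv_pos.2 (ha j)).le)
            n.cast_nonneg))
          (hA.permAvg_inv_diag_mul_mean_le_one i)
  rwa [← div_eq_mul_inv, div_le_one hP] at hle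

/-- If a feasible `ξ* ∈ D(v,d,q·1_d)` has completely symmetric
information matrix `N(ξ*) = a I_v + b J_v` and minimizes `trace(N̄(ξ)⁻¹)` over all
feasible designs, then `ξ*` is R-optimal in `D(v,d,q·1_d)`: it minimizes the product
of the diagonal entries of `N(ξ)⁻¹` over all feasible designs. -/
theorem completeSym_traceOpt_is_Ropt {v d q : ℕ} (hv : 2 ≤ v) (hd : 1 ≤ d) (hq : 1 ≤ q)
    (ξs : ExactDesign v d (fun _ => q))
    (hfeas : (ExactDesign.N ξs).PosDef)
    (hcs : ∃ a b : ℝ, ExactDesign.N ξs =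
      a • (1 : Matrix (Fin v) (Fin v) ℝ) + b • Matrix.of (fun _ _ => (1 : ℝ)))
    (hmin : ∀ ξ : ExactDesign v d (fun _ => q), (ExactDesign.N ξ).PosDef →
      (permAvg (ExactDesign.N ξs))⁻¹.trace ≤ (permAvg (ExactDesign.N ξ))⁻¹.trace) :
    ∀ ξ : ExactDesign v d (fun _ => q), (ExactDesign.N ξ).PosDef →
      ∏ i, (ExactDesign.N ξs)⁻¹ i i ≤ ∏ i, (ExactDesign.N ξ)⁻¹ i i := by
  intro ξ hξ
  obtain ⟨a, b, hab⟩ := hcs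
  have hinv : ∀ σ : Equiv.Perm (Fin v),
      (ExactDesign.N ξs).submatrix σ σ = ExactDesign.N ξs := by
    intro σ
    rw [hab]
    ext i j
    simp [Matrix.one_apply]
  let i₀ : Fin v := ⟨0, by omega⟩
  have htr : ∀ B : Matrix (Fin v) (Fin v) ℝ, (∀ σ : Equiv.Perm (Fin v), B.submatrix σ σ = B) →
      B⁻¹.trace = v * B⁻¹ i₀ i₀ := by
    intro B hB
    simp [Matrix.trace, fun i => Matrix.inv_diag_eq_of_submatrix_perm hB i i₀]
  have hle := hmin ξ hξ
  rw [permAvg_eq_self hinv, htr _ hinv, htr _ (permAvg_submatrix_perm _)] at hle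
  have hdiag := le_of_mul_le_mul_left hle (Nat.cast_pos.2 i₀.pos)
  calc ∏ i, (ExactDesign.N ξs)⁻¹ i i = (ExactDesign.N ξs)⁻¹ i₀ i₀ ^ v := by
        simp [fun i => Matrix.inv_diag_eq_of_submatrix_perm hinv i i₀]
    _ ≤ (permAvg (ExactDesign.N ξ))⁻¹ i₀ i₀ ^ v :=
        pow_le_pow_left₀ hfeas.inv.diag_pos.le hdiag v
    _ ≤ ∏ i, (ExactDesign.N ξ)⁻¹ i i := hξ.permAvg_inv_diag_pow_le_prod i₀
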